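/- arXiv:1704.00590 — 2 statements merged into one kernel-verified Lean document; each statement's English description precedes it below -/
import Mathlib

section
/- Let (X,G) be a G-complete G-metric space and let T : X → X be a G-continuous mapping such that there exists λ ∈ [0,1) with the property: for each x ∈ X there exists a positive integer n(x) such that G(T^{n(x)} x, T^{n(x)} y, T^{n(x)} z) ≤ λ · G(x, y, z) for all y, z ∈ X. Then for any initial point x_0 ∈ X, the sequence of iterates (T^n x_0)_{n ≥ 1} G-converges to the unique fixed point of T. -/
/-- A G-metric on a set `X`: a function `G : X × X × X → [0,∞)` satisfying
(G1) `G x x x = 0`; (G2) `G x x y > 0` for `x ≠ y`; (G3) `G x x y ≤ G x y z` for `z ≠ y`;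
(G4) symmetry in all three variables; (G5) `G x y z ≤ G x a a + G a y z`. -/
def IsGMetric {X : Type*} (G : X → X → X → ℝ) : Prop :=
  (∀ x y z, 0 ≤ G x y z) ∧
  (∀ x, G x x x = 0) ∧
  (∀ x y, x ≠ y → 0 < G x x y) ∧
  (∀ x y z, z ≠ y → G x x y ≤ G x y z) ∧
  (∀ x y z, G x y z = G x z y) ∧
  (∀ x y z, G x y z = G y z x) ∧
  (∀ x y z a, G x y z ≤ G x a a + G a y z)

/-- A sequence `s` G-converges to `x` iff `G x (s n) (s n) → 0`. -/
def GConvergesTo {X : Type*} (G : X → X → X → ℝ) (s : ℕ → X) (x : X) : Prop :=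
  Filter.Tendsto (fun n => G x (s n) (s n)) Filter.atTop (nhds 0)

/-- A sequence `s` is G-Cauchy iff for every `ε > 0` there is `N` with
`G (s n) (s m) (s m) < ε` for all `m, n ≥ N`. -/
def IsGCauchy {X : Type*} (G : X → X → X → ℝ) (s : ℕ → X) : Prop :=
  ∀ ε > (0 : ℝ), ∃ N : ℕ, ∀ m ≥ N, ∀ n ≥ N, G (s n) (s m) (s m) < ε

/-- `(X, G)` is G-complete iff every G-Cauchy sequence G-converges to some point. -/
def IsGComplete {X : Type*} (G : X → X → X → ℝ) : Prop :=
  ∀ s : ℕ → X, IsGCauchy G s → ∃ x, GConvergesTo G s x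

/-- `T` is G-continuous iff it maps G-convergent sequences to G-convergent sequences. -/
def IsGContinuous {X : Type*} (G : X → X → X → ℝ) (T : X → X) : Prop :=
  ∀ (s : ℕ → X) (x : X), GConvergesTo G s x → GConvergesTo G (fun n => T (s n)) (T x)

open Filter Topology

namespace IsGMetric

variable {X : Type*} {G : X → X → X → ℝ}

theorem triangle (hG : IsGMetric G) (x a y : X) : G x y y ≤ G x a a + G a y y :=
  hG.2.2.2.2.2.2 x y y a

theorem swap_le (hG : IsGMetric G) (x y : X) : G y x x ≤ 2 * G x y y := by
  obtain ⟨-, -, -, -, -, hrot, htri⟩ := hG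
  linarith [htri x x y y, hrot y x x, hrot y x y]

theorem eq_of_nonpos (hG : IsGMetric G) {x y : X} (h : G x y y ≤ 0) : x = y := by
  by_contra hne
  have hpos := hG.2.2.1 y x (Ne.symm hne)
  rw [← hG.2.2.2.2.2.1 x y y] at hpos
  linarith

theorem limit_unique (hG : IsGMetric G) {s : ℕ → X} {x y : X}
    (hx : GConvergesTo G s x) (hy : GConvergesTo G s y) : x = y := by
  have hlim : Tendsto (fun n => G x (s n) (s n) + 2 * G y (s n) (s n)) atTop (𝓝 0) := by
    simpa using Tendsto.add hx (Tendsto.const_mul 2 hy)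
  refine hG.eq_of_nonpos (ge_of_tendsto' hlim fun n => ?_)
  linarith [hG.triangle x (s n) y, hG.swap_le y (s n)]

/-- If some iterate of `T` contracts distances from `x`, then the orbit of `x` is bounded. -/
theorem exists_orbit_bound (hG : IsGMetric G) {T : X → X} {lam : ℝ} (hlam0 : 0 ≤ lam)
    (hlam1 : lam < 1) {x : X} {n : ℕ} (hn : 0 < n)
    (hx : ∀ y, G (T^[n] x) (T^[n] y) (T^[n] y) ≤ lam * G x y y) :
    ∃ B, ∀ k, G x (T^[k] x) (T^[k] x) ≤ B := by
  set q : ℕ → ℝ := fun k => G x (T^[k] x) (T^[k] x)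
  have hq0 : ∀ k, 0 ≤ q k := fun k => hG.1 _ _ _
  set M := ∑ j ∈ Finset.range (n + 1), q j
  have hqM : ∀ j ≤ n, q j ≤ M := fun j hj =>
    Finset.single_le_sum (fun i _ => hq0 i) (Finset.mem_range.2 (Nat.lt_succ_of_le hj))
  have hM0 : 0 ≤ M := (hq0 0).trans (hqM 0 n.zero_le)
  have h1 : 0 < 1 - lam := sub_pos.2 hlam1
  have hfix : M + lam * (M / (1 - lam)) = M / (1 - lam) := by
    field_simp
    ring
  have hMB : M ≤ M / (1 - lam) := by
    linarith [mul_nonneg hlam0 (div_nonneg hM0 h1.le)]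
  refine ⟨M / (1 - lam), fun k => ?_⟩
  induction k using Nat.strong_induction_on with
  | _ k ih =>
    rcases le_or_gt k n with hk | hk
    · exact (hqM k hk).trans hMB
    · obtain ⟨j, rfl⟩ := Nat.exists_eq_add_of_lt hk
      have hstep := hx (T^[j + 1] x)
      rw [← Function.iterate_add_apply, ← Nat.add_assoc] at hstep
      have hj := mul_le_mul_of_nonneg_left (ih (j + 1) (by omega)) hlam0
      have htri := hG.triangle x (T^[n] x) (T^[n + j + 1] x)
      have hnM : G x (T^[n] x) (T^[n] x) ≤ M := hqM n le_rfl
      linarith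

theorem isGCauchy_iterate (hG : IsGMetric G) {T : X → X} {lam : ℝ} (hlam0 : 0 ≤ lam)
    (hlam1 : lam < 1)
    (h : ∀ x, ∃ n, 0 < n ∧ ∀ y, G (T^[n] x) (T^[n] y) (T^[n] y) ≤ lam * G x y y) (x : X) :
    IsGCauchy G (fun k => T^[k] x) := by
  obtain ⟨n, hn, hx⟩ := h x
  obtain ⟨B, hB⟩ := hG.exists_orbit_bound hlam0 hlam1 hn hx
  have hdecay : ∀ i : ℕ, ∃ m, ∀ k,
      G (T^[m] x) (T^[k] (T^[m] x)) (T^[k] (T^[m] x)) ≤ lam ^ i * B := by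
    intro i
    induction i with
    | zero => exact ⟨0, by simpa using hB⟩
    | succ i ih =>
      obtain ⟨m, hm⟩ := ih
      obtain ⟨p, -, hp⟩ := h (T^[m] x)
      refine ⟨p + m, fun k => ?_⟩
      have hk := hp (T^[k] (T^[m] x))
      rw [← Function.iterate_add_apply T p k, Nat.add_comm p k,
        Function.iterate_add_apply T k p] at hk
      rw [Function.iterate_add_apply T p m]
      calc _ ≤ _ := hk
        _ ≤ lam * (lam ^ i * B) := mul_le_mul_of_nonneg_left (hm k) hlam0
        _ = lam ^ (i + 1) * B := by ring
  intro ε hε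
  have hlim : Tendsto (fun i : ℕ => 3 * (lam ^ i * B)) atTop (𝓝 0) := by
    simpa using ((tendsto_pow_atTop_nhds_zero_of_lt_one hlam0 hlam1).mul_const B).const_mul 3
  obtain ⟨i, hi⟩ := (hlim.eventually_lt_const hε).exists
  obtain ⟨m, hm⟩ := hdecay i
  have hbound : ∀ k ≥ m, G (T^[m] x) (T^[k] x) (T^[k] x) ≤ lam ^ i * B := fun k hk => by
    simpa [← Function.iterate_add_apply, Nat.sub_add_cancel hk] using hm (k - m)
  refine ⟨m, fun a ha b hb => ?_⟩
  linarith [hG.triangle (T^[b] x) (T^[m] x) (T^[a] x), hG.swap_le (T^[m] x) (T^[b] x),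
    hbound a ha, hbound b hb]

end IsGMetric

/-- **Corollary.** Under the hypotheses of the power-contraction fixed point theorem
(G-complete space, G-continuous `T`), for any initial point `x₀` the sequence of
iterates `(T^n x₀)_{n ≥ 1}` G-converges to the unique fixed point of `T`. -/
theorem gmetric_power_contraction_picard {X : Type*} [Nonempty X]
    (G : X → X → X → ℝ) (hG : IsGMetric G) (hcomp : IsGComplete G)
    (T : X → X) (hT : IsGContinuous G T)
    (lam : ℝ) (hlam0 : 0 ≤ lam) (hlam1 : lam < 1)
    (h : ∀ x : X, ∃ n : ℕ, 0 < n ∧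
      ∀ y z : X, G (T^[n] x) (T^[n] y) (T^[n] z) ≤ lam * G x y z) :
    ∃ ξ : X, T ξ = ξ ∧ (∀ η : X, T η = η → η = ξ) ∧
      ∀ x0 : X, GConvergesTo G (fun k => T^[k + 1] x0) ξ := by
  have hlimit : ∀ x, ∃ ξ, T ξ = ξ ∧ GConvergesTo G (fun k => T^[k + 1] x) ξ := by
    intro x
    obtain ⟨ξ, hξ⟩ := hcomp _ (hG.isGCauchy_iterate hlam0 hlam1
      (fun y => (h y).imp fun n hn => ⟨hn.1, fun z => hn.2 z z⟩) x)
    have hshift : GConvergesTo G (fun k => T^[k + 1] x) ξ := hξ.comp (tendsto_add_atTop_nat 1)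
    have himage : GConvergesTo G (fun k => T^[k + 1] x) (T ξ) := by
      simpa only [Function.iterate_succ_apply'] using hT _ _ hξ
    exact ⟨ξ, hG.limit_unique himage hshift, hshift⟩
  have hunique : ∀ ξ η, T ξ = ξ → T η = η → η = ξ := by
    intro ξ η hξ hη
    obtain ⟨n, -, hn⟩ := h η
    have hcontr := hn ξ ξ
    rw [Function.iterate_fixed hξ, Function.iterate_fixed hη] at hcontr
    exact hG.eq_of_nonpos (by nlinarith)
  obtain ⟨ξ, hξ, -⟩ := hlimit (Classical.arbitrary X)
  refine ⟨ξ, hξ, fun η => hunique ξ η hξ, fun x => ?_⟩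
  obtain ⟨η, hη, hconv⟩ := hlimit x
  rwa [hunique ξ η hξ hη] at hconv
end

section
/- Let X = [0,1] and define T : X → X by T(0) = 0 and, for each integer n ≥ 1 and x in the interval I_n = [1/2^n, 1/2^{n−1}]: T(x) = 1/2^{n+1} if x ∈ [1/2^n, (3n+5)/(2^{n+1}(n+2))], and T(x) = ((n+2)/(n+3))·(x − 1/2^{n−1}) + 1/2^n if x ∈ [(3n+5)/(2^{n+1}(n+2)), 1/2^{n−1}]. Then for every n ≥ 1 and x ∈ I_n, |T^{n+3} x − T^{n+3} y| ≤ (1/2)·|x − y| for all y ∈ [0,1]; moreover |T y − T 0| = T y ≤ (1/2)·y for all y ∈ [0,1]. In particular T satisfies the power-contraction condition with λ = 1/2, taking n(x) = n+3 for x ∈ I_n and n(0) = 1. -/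
open Classical in
/-- The map `T : [0,1] → [0,1]` of the example (extended by `0` outside `(0,1]`).
For `x` in the interval `I_n = [1/2^n, 1/2^(n-1)]` (`n ≥ 1`) it is given piecewise by
`T x = 1/2^(n+1)` for `x ∈ [1/2^n, (3n+5)/(2^(n+1)(n+2))]` and
`T x = ((n+2)/(n+3))·(x - 1/2^(n-1)) + 1/2^n` for
`x ∈ [(3n+5)/(2^(n+1)(n+2)), 1/2^(n-1)]`; the two formulas are consistent on all
overlaps of the intervals `I_n`. Here `Nat.find` picks, for `0 < x ≤ 1`, the least
`n` with `1/2^n < x`, so that `x ∈ (1/2^n, 1/2^(n-1)] ⊆ I_n`. -/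
noncomputable def Tmap (x : ℝ) : ℝ :=
  if hx : 0 < x ∧ x ≤ 1 then
    let n : ℕ := Nat.find (exists_pow_lt_of_lt_one hx.1 (by norm_num : (1 / 2 : ℝ) < 1))
    if x ≤ (3 * (n : ℝ) + 5) / (2 ^ (n + 1) * ((n : ℝ) + 2)) then 1 / 2 ^ (n + 1)
    else (((n : ℝ) + 2) / ((n : ℝ) + 3)) * (x - 1 / 2 ^ (n - 1)) + 1 / 2 ^ n
  else 0

theorem half_pow_succ (n : ℕ) : (1 : ℝ) / 2 ^ (n + 1) = 1 / 2 ^ n / 2 := by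
  rw [pow_succ, div_div]

/-- Closed form of `Tmap` on the half-open dyadic interval. -/
theorem Tmap_eq_max_of_lt (n : ℕ) {x : ℝ} (hl : 1 / 2 ^ (n + 1) < x) (hr : x ≤ 1 / 2 ^ n) :
    Tmap x = max (1 / 2 ^ (n + 2))
      (((n : ℝ) + 3) / ((n : ℝ) + 4) * (x - 1 / 2 ^ n) + 1 / 2 ^ (n + 1)) := by
  have hx0 : 0 < x := lt_trans (by positivity) hl
  have hx1 : x ≤ 1 := hr.trans (by
    rw [div_le_one (by positivity)]; exact one_le_pow₀ (by norm_num))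
  have hx : 0 < x ∧ x ≤ 1 := ⟨hx0, hx1⟩
  have hfind : ∀ h : ∃ k : ℕ, (1 / 2 : ℝ) ^ k < x, ∀ d : DecidablePred fun k : ℕ =>
      (1 / 2 : ℝ) ^ k < x, @Nat.find _ d h = n + 1 := by
    intro h d
    rw [Nat.find_eq_iff]
    refine ⟨by rwa [one_div_pow], fun k hk => not_lt.2 (hr.trans ?_)⟩
    rw [← one_div_pow]
    exact pow_le_pow_of_le_one (by norm_num) (by norm_num) (by omega)
  unfold Tmap
  rw [dif_pos hx]
  simp only [hfind, Nat.add_sub_cancel]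
  have hb : (3 * ((n + 1 : ℕ) : ℝ) + 5) / (2 ^ (n + 1 + 1) * (((n + 1 : ℕ) : ℝ) + 2))
      = 1 / 2 ^ n - (n + 4) / (n + 3) * (1 / 2 ^ (n + 2)) := by
    push_cast
    field_simp
    ring
  have hc : (((n + 1 : ℕ) : ℝ) + 2) / (((n + 1 : ℕ) : ℝ) + 3) = (n + 3) / (n + 4) := by
    push_cast
    congr 1 <;> ring
  have hq : (1 : ℝ) / 2 ^ (n + 1) = 2 * (1 / 2 ^ (n + 2)) := by
    rw [half_pow_succ (n + 1)]; ring
  have hcinv : ((n : ℝ) + 3) / (n + 4) * ((n + 4) / (n + 3)) = 1 := by field_simp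
  have hc0 : (0 : ℝ) < (n + 3) / (n + 4) := by positivity
  rw [hb, hc]
  split_ifs with h
  · rw [max_eq_left]
    have := mul_le_mul_of_nonneg_left h hc0.le
    linear_combination this + hq + 1 / 2 ^ (n + 2) * hcinv * (-1)
  · rw [max_eq_right]
    have := mul_le_mul_of_nonneg_left (not_le.1 h).le hc0.le
    linear_combination this - hq + 1 / 2 ^ (n + 2) * hcinv

theorem Tmap_half_pow (n : ℕ) : Tmap (1 / 2 ^ n) = 1 / 2 ^ (n + 1) := by
  have hp : (0 : ℝ) < 1 / 2 ^ (n + 1) := by positivity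
  rw [Tmap_eq_max_of_lt n (by rw [half_pow_succ] at hp ⊢; linarith) le_rfl, sub_self, mul_zero,
    zero_add, max_eq_right]
  rw [half_pow_succ (n + 1)]
  linarith

/-- Closed form of `Tmap` on the closed dyadic interval. -/
theorem Tmap_eq_max (n : ℕ) {x : ℝ} (hl : 1 / 2 ^ (n + 1) ≤ x) (hr : x ≤ 1 / 2 ^ n) :
    Tmap x = max (1 / 2 ^ (n + 2))
      (((n : ℝ) + 3) / ((n : ℝ) + 4) * (x - 1 / 2 ^ n) + 1 / 2 ^ (n + 1)) := by
  rcases hl.lt_or_eq with h | rfl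
  · exact Tmap_eq_max_of_lt n h hr
  · rw [Tmap_half_pow, max_eq_left]
    have hc : (1 : ℝ) / 2 ≤ (n + 3) / (n + 4) := by
      rw [div_le_div_iff₀ (by norm_num) (by positivity)]
      have : (0 : ℝ) ≤ n := n.cast_nonneg
      linarith
    have hp : (0 : ℝ) < 1 / 2 ^ n := by positivity
    rw [half_pow_succ (n + 1), half_pow_succ n]
    nlinarith

theorem Tmap_zero : Tmap 0 = 0 := by simp [Tmap]

theorem exists_dyadic {x : ℝ} (h0 : 0 < x) (h1 : x ≤ 1) :
    ∃ n : ℕ, 1 / 2 ^ (n + 1) < x ∧ x ≤ 1 / 2 ^ n := by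
  simpa only [one_div_pow] using
    exists_nat_pow_near_of_lt_one h0 h1 (by norm_num : (0 : ℝ) < 1 / 2) (by norm_num)

theorem Tmap_mem_Icc {x : ℝ} (hx : x ∈ Set.Icc (0 : ℝ) 1) : Tmap x ∈ Set.Icc 0 (x / 2) := by
  rcases hx.1.eq_or_lt with rfl | h0
  · simp [Tmap_zero]
  obtain ⟨n, hl, hr⟩ := exists_dyadic h0 hx.2
  rw [Tmap_eq_max n hl.le hr]
  refine ⟨le_max_of_le_left (by positivity), max_le ?_ ?_⟩
  · rw [half_pow_succ (n + 1)]
    linarith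
  · have hc : (1 : ℝ) / 2 ≤ (n + 3) / (n + 4) := by
      rw [div_le_div_iff₀ (by norm_num) (by positivity)]
      have : (0 : ℝ) ≤ n := n.cast_nonneg
      linarith
    rw [half_pow_succ n]
    nlinarith

theorem Tmap_iterate_mem_Icc (k : ℕ) {x : ℝ} (hx : x ∈ Set.Icc (0 : ℝ) 1) :
    Tmap^[k] x ∈ Set.Icc 0 (x / 2 ^ k) := by
  induction k generalizing x with
  | zero => simpa using hx.1
  | succ k ih =>
    have h := Tmap_mem_Icc hx
    have h' := ih (x := Tmap x) ⟨h.1, by linarith [h.2, hx.1, hx.2]⟩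
    rw [Function.iterate_succ_apply]
    refine ⟨h'.1, h'.2.trans ?_⟩
    rw [pow_succ', ← div_div]
    gcongr
    exact h.2

theorem Tmap_sub_mem_Icc_of_dyadic (n : ℕ) {a b : ℝ} (ha : 1 / 2 ^ (n + 1) ≤ a) (hab : a ≤ b)
    (hb : b ≤ 1 / 2 ^ n) :
    Tmap b - Tmap a ∈ Set.Icc 0 (((n : ℝ) + 3) / (n + 4) * (b - a)) := by
  rw [Tmap_eq_max n ha (hab.trans hb), Tmap_eq_max n (ha.trans hab) hb]
  have hc : (0 : ℝ) ≤ (n + 3) / (n + 4) := by positivity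
  have h := mul_nonneg hc (sub_nonneg.2 hab)
  constructor
  · rw [sub_nonneg]
    gcongr
  · rw [sub_le_iff_le_add]
    refine max_le ?_ ?_
    · exact le_add_of_nonneg_of_le h (le_max_left _ _)
    · calc _ = ((n : ℝ) + 3) / (n + 4) * (b - a) +
            (((n : ℝ) + 3) / (n + 4) * (a - 1 / 2 ^ n) + 1 / 2 ^ (n + 1)) := by ring
        _ ≤ _ := by gcongr; exact le_max_right _ _

/-- `Tmap` is monotone with Lipschitz constant `(m + 2) / (m + 3)` on `[1 / 2 ^ m, 1]`. -/
theorem Tmap_sub_mem_Icc (m : ℕ) {a b : ℝ} (ha : 1 / 2 ^ m ≤ a) (hab : a ≤ b) (hb : b ≤ 1) :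
    Tmap b - Tmap a ∈ Set.Icc 0 (((m : ℝ) + 2) / (m + 3) * (b - a)) := by
  induction m generalizing a b with
  | zero =>
    obtain rfl : a = b := le_antisymm hab (hb.trans (by simpa using ha))
    simp
  | succ m ih =>
    have hslope : ((m : ℝ) + 2) / (m + 3) ≤ (m + 3) / (m + 4) := by
      rw [div_le_div_iff₀ (by positivity) (by positivity)]
      nlinarith
    have hcast : (((m + 1 : ℕ) : ℝ) + 2) / (((m + 1 : ℕ) : ℝ) + 3) = (m + 3) / (m + 4) := by
      push_cast
      congr 1 <;> ring
    have upper : ∀ {a b : ℝ}, 1 / 2 ^ m ≤ a → a ≤ b → b ≤ 1 →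
        Tmap b - Tmap a ∈ Set.Icc 0 (((m : ℝ) + 3) / (m + 4) * (b - a)) := fun ha hab hb =>
      ⟨(ih ha hab hb).1, (ih ha hab hb).2.trans
        (mul_le_mul_of_nonneg_right hslope (sub_nonneg.2 hab))⟩
    rw [hcast]
    rcases le_total (1 / 2 ^ m) a with h | h
    · exact upper h hab hb
    rcases le_total b (1 / 2 ^ m) with h' | h'
    · exact Tmap_sub_mem_Icc_of_dyadic m ha hab h'
    obtain ⟨l₁, u₁⟩ := Tmap_sub_mem_Icc_of_dyadic m ha h le_rfl
    obtain ⟨l₂, u₂⟩ := upper le_rfl h' hb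
    exact ⟨by linarith, by linarith⟩

theorem half_pow_succ_le_Tmap (m : ℕ) {x : ℝ} (hx : 1 / 2 ^ m ≤ x) (hx1 : x ≤ 1) :
    1 / 2 ^ (m + 1) ≤ Tmap x := by
  have := (Tmap_sub_mem_Icc m le_rfl hx hx1).1
  rw [Tmap_half_pow] at this
  linarith

theorem Tmap_iterate_sub_mem_Icc (k m : ℕ) {a b : ℝ} (ha : 1 / 2 ^ m ≤ a) (hab : a ≤ b)
    (hb : b ≤ 1) :
    Tmap^[k] b - Tmap^[k] a ∈ Set.Icc 0 (((m : ℝ) + 2) / (m + k + 2) * (b - a)) := by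
  induction k generalizing m a b with
  | zero =>
    have : (m : ℝ) + 2 ≠ 0 := by positivity
    simpa [this] using hab
  | succ k ih =>
    have h := Tmap_sub_mem_Icc m ha hab hb
    have hb0 : 0 ≤ b := le_trans (by positivity) (ha.trans hab)
    have hTb := (Tmap_mem_Icc ⟨hb0, hb⟩).2
    obtain ⟨l, u⟩ := ih (m + 1) (half_pow_succ_le_Tmap m ha (hab.trans hb))
      (sub_nonneg.1 h.1) (by linarith)
    rw [Function.iterate_succ_apply, Function.iterate_succ_apply]
    refine ⟨l, u.trans ?_⟩
    calc _ ≤ (((m + 1 : ℕ) : ℝ) + 2) / ((m + 1 : ℕ) + k + 2) *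
          (((m : ℝ) + 2) / (m + 3) * (b - a)) := by
            gcongr
            exact h.2
      _ = _ := by
        push_cast
        field_simp
        ring

theorem abs_Tmap_iterate_sub_le {n : ℕ} {x y : ℝ} (hnx : 1 / 2 ^ n ≤ x) (hx : x ≤ 1)
    (hy : y ∈ Set.Icc (0 : ℝ) 1) :
    |Tmap^[n + 3] x - Tmap^[n + 3] y| ≤ (1 / 2 : ℝ) * |x - y| := by
  have hp : (0 : ℝ) < 1 / 2 ^ n := by positivity
  have hs := half_pow_succ n
  rcases le_total (1 / 2 ^ (n + 1)) y with h | h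
  · have key : ∀ {a b : ℝ}, 1 / 2 ^ (n + 1) ≤ a → a ≤ b → b ≤ 1 →
        |Tmap^[n + 3] b - Tmap^[n + 3] a| ≤ (1 / 2 : ℝ) * |b - a| := by
      intro a b ha hab hb
      obtain ⟨l, u⟩ := Tmap_iterate_sub_mem_Icc (n + 3) (n + 1) ha hab hb
      rw [abs_of_nonneg l, abs_of_nonneg (sub_nonneg.2 hab)]
      have hhalf : (((n + 1 : ℕ) : ℝ) + 2) / ((n + 1 : ℕ) + (n + 3 : ℕ) + 2) = 1 / 2 := by
        rw [div_eq_div_iff (by positivity) (by norm_num)]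
        push_cast
        ring
      rwa [hhalf] at u
    rcases le_total x y with hxy | hxy
    · rw [abs_sub_comm, abs_sub_comm x]
      exact key (by linarith) hxy hy.2
    · exact key h hxy hx
  · obtain ⟨lx, ux⟩ := Tmap_iterate_mem_Icc (n + 3) (x := x) ⟨by linarith, hx⟩
    obtain ⟨ly, uy⟩ := Tmap_iterate_mem_Icc (n + 3) hy
    have hyx : y ≤ x := by linarith
    have hle : y / 2 ^ (n + 3) ≤ x / 2 ^ (n + 3) := by gcongr
    have h8 : x / 2 ^ (n + 3) ≤ x / 4 := by
      have : (4 : ℝ) ≤ 2 ^ (n + 3) := by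
        have : (1 : ℝ) ≤ 2 ^ n := one_le_pow₀ (by norm_num)
        rw [pow_add]
        linarith
      have hx0 : 0 ≤ x := by linarith
      gcongr
    rw [abs_of_nonneg (sub_nonneg.2 hyx), abs_le]
    constructor <;> linarith

/-- **Example (power-contraction condition with `λ = 1/2`).** For every `n ≥ 1` and
`x ∈ I_n = [1/2^n, 1/2^(n-1)]`, the iterate `T^[n+3]` is `1/2`-contractive at `x`
against every `y ∈ [0,1]`; moreover `|T y - T 0| = T y ≤ (1/2)·y` for `y ∈ [0,1]`.
In particular `T` satisfies the power-contraction condition with `λ = 1/2`, taking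
`n(x) = n + 3` for `x ∈ I_n` and `n(0) = 1`. -/
theorem Tmap_power_contraction :
    (∀ n : ℕ, 1 ≤ n → ∀ x ∈ Set.Icc ((1 : ℝ) / 2 ^ n) ((1 : ℝ) / 2 ^ (n - 1)),
      ∀ y ∈ Set.Icc (0 : ℝ) 1,
        |Tmap^[n + 3] x - Tmap^[n + 3] y| ≤ (1 / 2 : ℝ) * |x - y|) ∧
    (∀ y ∈ Set.Icc (0 : ℝ) 1, |Tmap y - Tmap 0| = Tmap y ∧ Tmap y ≤ (1 / 2 : ℝ) * y) ∧
    (∀ x ∈ Set.Icc (0 : ℝ) 1, ∃ m : ℕ, 0 < m ∧ ∀ y ∈ Set.Icc (0 : ℝ) 1,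
      |Tmap^[m] x - Tmap^[m] y| ≤ (1 / 2 : ℝ) * |x - y|) := by
  have fixed_zero : ∀ y ∈ Set.Icc (0 : ℝ) 1,
      |Tmap y - Tmap 0| = Tmap y ∧ Tmap y ≤ (1 / 2 : ℝ) * y := by
    intro y hy
    obtain ⟨l, u⟩ := Tmap_mem_Icc hy
    rw [Tmap_zero, sub_zero]
    exact ⟨abs_of_nonneg l, by linarith⟩
  refine ⟨fun n _ x hx y hy => abs_Tmap_iterate_sub_le hx.1 (hx.2.trans ?_) hy, fixed_zero,
    fun x hx => ?_⟩
  · rw [div_le_one (by positivity)]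
    exact one_le_pow₀ (by norm_num)
  · rcases hx.1.eq_or_lt with rfl | h0
    · refine ⟨1, one_pos, fun y hy => ?_⟩
      obtain ⟨he, hle⟩ := fixed_zero y hy
      rw [Function.iterate_one, abs_sub_comm, he, zero_sub, abs_neg, abs_of_nonneg hy.1]
      exact hle
    · obtain ⟨n, hl, -⟩ := exists_dyadic h0 hx.2
      exact ⟨n + 1 + 3, by omega, fun y hy => abs_Tmap_iterate_sub_le hl.le hx.2 hy⟩
end
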